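/- Let ρ ∈ 𝕊^m(ℝⁿ;𝒜_θ), m ∈ ℝ. Then, for every multi-order α ∈ ℕ₀ⁿ, the iterated finite difference Δ^αρ belongs to 𝕊^{m−|α|}(ℝⁿ;𝒜_θ), and Δ^αρ − ∂_ξ^αρ belongs to 𝕊^{m−|α|−1}(ℝⁿ;𝒜_θ). -/

import Mathlib

open Complex Filter Topology
open scoped ComplexOrder Real BigOperators

noncomputable section

/-- Euclidean space `ℝⁿ`. -/
abbrev Rn (n : ℕ) : Type := EuclideanSpace ℝ (Fin n)

/-- `ℝⁿ × ℝⁿ`. -/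
abbrev R2n (n : ℕ) : Type := Rn n × Rn n

/-- Length `|β|` of a multi-order `β ∈ ℕ₀ⁿ`. -/
def mdeg {n : ℕ} (b : Fin n → ℕ) : ℕ := ∑ j, b j

/-- Composition of a list of self-maps. -/
def compList {X : Type*} (l : List (X → X)) : X → X := l.foldr (· ∘ ·) id

/-- The phase `c(k,l) = Σ_{q<p} k_p θ_{pq} l_q`. -/
def cPhase {n : ℕ} (θ : Matrix (Fin n) (Fin n) ℝ) (k l : Fin n → ℤ) : ℝ :=
  ∑ p, ∑ q, if q < p then (k p : ℝ) * θ p q * (l q : ℝ) else 0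

/-- Euclidean norm `|k|` of a lattice point `k ∈ ℤⁿ`. -/
def znorm {n : ℕ} (k : Fin n → ℤ) : ℝ := Real.sqrt (∑ j, ((k j : ℝ)) ^ 2)

/-- `k^β = ∏ k_jᵝ`. -/
def kpow {n : ℕ} (b : Fin n → ℕ) (k : Fin n → ℤ) : ℝ := ∏ j, ((k j : ℝ)) ^ (b j)

/-- A lattice point `k ∈ ℤⁿ` viewed as a point of `ℝⁿ`. -/
def zEmb {n : ℕ} (k : Fin n → ℤ) : Rn n := (WithLp.equiv 2 (Fin n → ℝ)).symm (fun j => (k j : ℝ))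

variable {n : ℕ} {A : Type} [NormedRing A] [StarRing A] [CStarRing A]
  [NormedAlgebra ℂ A] [StarModule ℂ A] [CompleteSpace A]

/-- The derivation `δ_j u = (1/i) ∂_{s_j} α_s(u)|_{s=0}`. -/
def δd (αa : Rn n → (A ≃⋆ₐ[ℂ] A)) (j : Fin n) (u : A) : A :=
  (-Complex.I) • fderiv ℝ (fun s : Rn n => αa s u) 0 (EuclideanSpace.single j 1)

/-- `δ^β = δ_1^{β_1} ⋯ δ_n^{β_n}`. -/
def δpow (αa : Rn n → (A ≃⋆ₐ[ℂ] A)) (b : Fin n → ℕ) : A → A :=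
  compList (List.ofFn fun j => (δd αa j)^[b j])

/-- The smooth noncommutative torus `𝒜_θ`: elements with `C^∞` orbit map. -/
def SmoothSet (αa : Rn n → (A ≃⋆ₐ[ℂ] A)) : Set A :=
  {u | ∀ N : ℕ, ContDiff ℝ N (fun s : Rn n => αa s u)}

/-- `A_θ^{(N)}`: elements with `C^N` orbit map. -/
def CNSet (αa : Rn n → (A ≃⋆ₐ[ℂ] A)) (N : ℕ) : Set A :=
  {u | ContDiff ℝ N (fun s : Rn n => αa s u)}

/-- The Fréchet seminorms `‖u‖_{(N)} = sup_{|β| ≤ N} ‖δ^β(u)‖` of `𝒜_θ`. -/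
def frSemi (αa : Rn n → (A ≃⋆ₐ[ℂ] A)) (N : ℕ) (u : A) : ℝ :=
  ⨆ b : {b : Fin n → ℕ // mdeg b ≤ N}, ‖δpow αa b.1 u‖

/-- Partial derivative `∂_{ξ_j}` of maps `ℝⁿ → A`. -/
def pd {n : ℕ} (j : Fin n) (f : Rn n → A) : Rn n → A :=
  fun ξ => fderiv ℝ f ξ (EuclideanSpace.single j 1)

/-- Iterated partial derivative `∂_ξ^β` of maps `ℝⁿ → A`. -/
def pdPow {n : ℕ} (b : Fin n → ℕ) : (Rn n → A) → (Rn n → A) :=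
  compList (List.ofFn fun j => (pd j)^[b j])

/-- Partial derivative `∂_{s_j}` (first variable) of maps `ℝⁿ×ℝⁿ → A`. -/
def pdS {n : ℕ} (j : Fin n) (f : R2n n → A) : R2n n → A :=
  fun x => fderiv ℝ f x (EuclideanSpace.single j 1, 0)

/-- Partial derivative `∂_{ξ_j}` (second variable) of maps `ℝⁿ×ℝⁿ → A`. -/
def pdXi {n : ℕ} (j : Fin n) (f : R2n n → A) : R2n n → A :=
  fun x => fderiv ℝ f x (0, EuclideanSpace.single j 1)

/-- `∂_s^β`. -/
def pdSPow {n : ℕ} (b : Fin n → ℕ) : (R2n n → A) → (R2n n → A) :=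
  compList (List.ofFn fun j => (pdS j)^[b j])

/-- `∂_ξ^γ`. -/
def pdXiPow {n : ℕ} (b : Fin n → ℕ) : (R2n n → A) → (R2n n → A) :=
  compList (List.ofFn fun j => (pdXi j)^[b j])

/-- Forward difference operator `Δ_j` on maps `ℝⁿ → A`. -/
def fdiff {n : ℕ} (j : Fin n) (f : Rn n → A) : Rn n → A :=
  fun ξ => f (ξ + EuclideanSpace.single j 1) - f ξ

/-- `Δ^β` on maps `ℝⁿ → A`. -/
def fdiffPow {n : ℕ} (b : Fin n → ℕ) : (Rn n → A) → (Rn n → A) :=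
  compList (List.ofFn fun j => (fdiff j)^[b j])

/-- Forward difference operator `Δ_j` on sequences `ℤⁿ → A`. -/
def zdiff {n : ℕ} (j : Fin n) (f : (Fin n → ℤ) → A) : (Fin n → ℤ) → A :=
  fun k => f (k + Pi.single j 1) - f k

/-- `Δ^β` on sequences `ℤⁿ → A`. -/
def zdiffPow {n : ℕ} (b : Fin n → ℕ) : ((Fin n → ℤ) → A) → ((Fin n → ℤ) → A) :=
  compList (List.ofFn fun j => (zdiff j)^[b j])

/-- The symbol class `𝕊^m(ℝⁿ; 𝒜_θ)`. -/
def IsSymbol (αa : Rn n → (A ≃⋆ₐ[ℂ] A)) (m : ℝ) (ρ : Rn n → A) : Prop :=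
  (∀ ξ, ρ ξ ∈ SmoothSet αa) ∧
  (∀ a : Fin n → ℕ, ∀ N : ℕ, ContDiff ℝ N fun ξ => δpow αa a (ρ ξ)) ∧
  (∀ a b : Fin n → ℕ, ∃ C > 0, ∀ ξ,
    ‖δpow αa a (pdPow b ρ ξ)‖ ≤ C * (1 + ‖ξ‖) ^ (m - (mdeg b : ℝ)))

/-- The class `𝒮(ℝⁿ; 𝒜_θ) = ∩ₘ 𝕊^m(ℝⁿ; 𝒜_θ)`. -/
def IsSchwartzSym (αa : Rn n → (A ≃⋆ₐ[ℂ] A)) (ρ : Rn n → A) : Prop :=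
  ∀ m : ℝ, IsSymbol αa m ρ

/-- The seminorm `p_N^{(m)}` on `𝕊^m(ℝⁿ; 𝒜_θ)`. -/
def pSemi (αa : Rn n → (A ≃⋆ₐ[ℂ] A)) (m : ℝ) (N : ℕ) (ρ : Rn n → A) : ℝ :=
  ⨆ q : {ab : (Fin n → ℕ) × (Fin n → ℕ) // mdeg ab.1 + mdeg ab.2 ≤ N} × Rn n,
    (1 + ‖q.2‖) ^ (-m + (mdeg q.1.1.2 : ℝ)) * ‖δpow αa q.1.1.1 (pdPow q.1.1.2 ρ q.2)‖

/-- The amplitude class `A^m(ℝⁿ×ℝⁿ; 𝒜_θ)`. -/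
def IsAmplitude (αa : Rn n → (A ≃⋆ₐ[ℂ] A)) (m : ℝ) (a : R2n n → A) : Prop :=
  (∀ x, a x ∈ SmoothSet αa) ∧
  (∀ c : Fin n → ℕ, ∀ N : ℕ, ContDiff ℝ N fun x => δpow αa c (a x)) ∧
  (∀ c b g : Fin n → ℕ, ∃ C > 0, ∀ x : R2n n,
    ‖δpow αa c (pdSPow b (pdXiPow g a) x)‖ ≤ C * (1 + ‖x.1‖ + ‖x.2‖) ^ m)

/-- The seminorm `q_N^{(m)}` on `A^m(ℝⁿ×ℝⁿ; 𝒜_θ)`. -/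
def qSemi (αa : Rn n → (A ≃⋆ₐ[ℂ] A)) (m : ℝ) (N : ℕ) (a : R2n n → A) : ℝ :=
  ⨆ q : {t : (Fin n → ℕ) × (Fin n → ℕ) × (Fin n → ℕ) //
      mdeg t.1 + mdeg t.2.1 + mdeg t.2.2 ≤ N} × R2n n,
    (1 + ‖q.2.1‖ + ‖q.2.2‖) ^ (-m) *
      ‖δpow αa q.1.1.1 (pdSPow q.1.1.2.1 (pdXiPow q.1.1.2.2 a) q.2)‖

/-- The toroidal symbol class `𝕊^m(ℤⁿ; 𝒜_θ)`. -/
def IsToroidal (αa : Rn n → (A ≃⋆ₐ[ℂ] A)) (m : ℝ) (ρ : (Fin n → ℤ) → A) : Prop :=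
  (∀ k, ρ k ∈ SmoothSet αa) ∧
  (∀ a b : Fin n → ℕ, ∃ C > 0, ∀ k,
    ‖δpow αa a (zdiffPow b ρ k)‖ ≤ C * (1 + znorm k) ^ (m - (mdeg b : ℝ)))

/-- The coefficient `(1-χ)/(|s|²+|ξ|²)` of the operator `L`. -/
def Lcoef {n : ℕ} (χc : R2n n → ℝ) (x : R2n n) : ℝ := (1 - χc x) / (‖x.1‖ ^ 2 + ‖x.2‖ ^ 2)

/-- The transpose `L^t` of `L = χ + (1-χ)(|s|²+|ξ|²)^{-1} Σ (ξ_j D_{s_j} + s_j D_{ξ_j})`,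
namely `L^t u = χ u - Σ_j (D_{s_j}((1-χ)(|s|²+|ξ|²)^{-1} ξ_j u) + D_{ξ_j}(… s_j u))`. -/
def Ltrans (χc : R2n n → ℝ) (u : R2n n → A) : R2n n → A := fun x =>
  χc x • u x -
    ∑ j, ((-Complex.I) • pdS j (fun y => (Lcoef χc y * y.2 j) • u y) x +
      (-Complex.I) • pdXi j (fun y => (Lcoef χc y * y.1 j) • u y) x)

/-- The (regularized) oscillating integral `(2π)^{-n} ∬ e^{is·ξ} (L^t)^N[a(s,ξ)] ds dξ`. -/
def Josc (χc : R2n n → ℝ) (N : ℕ) (a : R2n n → A) : A :=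
  ((2 * Real.pi) ^ n)⁻¹ •
    MeasureTheory.integral MeasureTheory.volume
      (fun x : R2n n => Complex.exp (Complex.I * ((∑ j, x.1 j * x.2 j : ℝ) : ℂ)) •
        ((Ltrans χc)^[N] a) x)

/-- A convenient integer `> m + 2n`. -/
def Nfor (n : ℕ) (m : ℝ) : ℕ := ⌈m⌉₊ + 2 * n + 1

section MultiPower

/-- The operator `D_1^{b_1} ⋯ D_n^{b_n}` attached to a family of self-maps `D`. -/
def multiPow {X : Type*} {n : ℕ} (D : Fin n → X → X) (b : Fin n → ℕ) : X → X :=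
  compList (List.ofFn fun j => (D j)^[b j])

variable {X Y : Type*}

lemma iterate_mem_of_mapsTo {f : X → X} {S : Set X} (hf : ∀ x ∈ S, f x ∈ S) (k : ℕ) :
    ∀ x ∈ S, f^[k] x ∈ S := fun _ hx => Set.MapsTo.iterate hf k hx

lemma compList_map_semiconj {ι : Type*} {f : ι → X → X} {f' : ι → Y → Y} {g : X → Y} {S : Set X}
    (hf : ∀ i, ∀ x ∈ S, f i x ∈ S) (hg : ∀ i, ∀ x ∈ S, g (f i x) = f' i (g x)) (l : List ι) :
    ∀ x ∈ S, compList (l.map f) x ∈ S ∧ g (compList (l.map f) x) = compList (l.map f') (g x) := by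
  induction l with
  | nil => intro x hx; exact ⟨hx, rfl⟩
  | cons i l ih =>
    intro x hx
    obtain ⟨h1, h2⟩ := ih x hx
    refine ⟨hf i _ h1, ?_⟩
    change g (f i (compList (l.map f) x)) = f' i (compList (l.map f') (g x))
    rw [hg i _ h1, h2]

lemma iterate_semiconj {f : X → X} {f' : Y → Y} {g : X → Y} {S : Set X}
    (hf : ∀ x ∈ S, f x ∈ S) (hg : ∀ x ∈ S, g (f x) = f' (g x)) (k : ℕ) :
    ∀ x ∈ S, g (f^[k] x) = f'^[k] (g x) := by
  induction k with
  | zero => intro x _; rfl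
  | succ k ih =>
    intro x hx
    rw [Function.iterate_succ_apply, Function.iterate_succ_apply, ih _ (hf x hx), hg x hx]

variable {n : ℕ} {D : Fin n → X → X} {D' : Fin n → Y → Y} {S : Set X}

lemma multiPow_mem (hD : ∀ j, ∀ x ∈ S, D j x ∈ S) (b : Fin n → ℕ) {x : X} (hx : x ∈ S) :
    multiPow D b x ∈ S := by
  rw [multiPow, List.ofFn_eq_map]
  exact (compList_map_semiconj (g := id) (f' := fun j => (D j)^[b j])
    (fun j => iterate_mem_of_mapsTo (hD j) (b j)) (fun _ _ _ => rfl) _ x hx).1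

lemma multiPow_semiconj (hD : ∀ j, ∀ x ∈ S, D j x ∈ S) {g : X → Y}
    (hg : ∀ j, ∀ x ∈ S, g (D j x) = D' j (g x)) (b : Fin n → ℕ) {x : X} (hx : x ∈ S) :
    g (multiPow D b x) = multiPow D' b (g x) := by
  rw [multiPow, multiPow, List.ofFn_eq_map, List.ofFn_eq_map]
  exact (compList_map_semiconj (fun j => iterate_mem_of_mapsTo (hD j) (b j))
    (fun j => iterate_semiconj (hD j) (hg j) (b j)) _ x hx).2

lemma multiPow_binop {op : X → X → X} (hD : ∀ j, ∀ x ∈ S, D j x ∈ S)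
    (hop : ∀ j, ∀ x ∈ S, ∀ y ∈ S, D j (op x y) = op (D j x) (D j y)) (b : Fin n → ℕ)
    {x y : X} (hx : x ∈ S) (hy : y ∈ S) :
    multiPow D b (op x y) = op (multiPow D b x) (multiPow D b y) := by
  have hfst := multiPow_semiconj (S := Set.univ) (D := fun j => Prod.map (D j) (D j)) (D' := D)
    (g := Prod.fst) (fun _ _ _ => trivial) (fun _ _ _ => rfl) b (x := (x, y)) trivial
  have hsnd := multiPow_semiconj (S := Set.univ) (D := fun j => Prod.map (D j) (D j)) (D' := D)
    (g := Prod.snd) (fun _ _ _ => trivial) (fun _ _ _ => rfl) b (x := (x, y)) trivial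
  have h := multiPow_semiconj (S := S ×ˢ S) (D := fun j => Prod.map (D j) (D j)) (D' := D)
    (g := fun p => op p.1 p.2) (fun j p hp => ⟨hD j _ hp.1, hD j _ hp.2⟩)
    (fun j p hp => (hop j _ hp.1 _ hp.2).symm) b (x := (x, y)) ⟨hx, hy⟩
  rw [← h, hfst, hsnd]

lemma multiPow_zero (x : X) : multiPow D 0 x = x := by
  have h : ∀ l : List (Fin n), compList (l.map fun j => (D j)^[(0 : Fin n → ℕ) j]) x = x := by
    intro l
    induction l with
    | nil => rfl
    | cons i l ih => exact ih
  rw [multiPow, List.ofFn_eq_map, h]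

lemma compList_map_iterate_add_single (hD : ∀ j, ∀ x ∈ S, D j x ∈ S)
    (hc : ∀ i j, ∀ x ∈ S, D i (D j x) = D j (D i x)) (b : Fin n → ℕ) (i : Fin n)
    (l : List (Fin n)) (hl : l.Nodup) {x : X} (hx : x ∈ S) :
    compList (l.map fun j => (D j)^[(b + Pi.single i 1 : Fin n → ℕ) j]) x =
      if i ∈ l then compList (l.map fun j => (D j)^[b j]) (D i x)
      else compList (l.map fun j => (D j)^[b j]) x := by
  induction l with
  | nil => rfl
  | cons k l ih =>
    have ih := ih hl.of_cons
    have hk : k ∉ l := (List.nodup_cons.1 hl).1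
    change (D k)^[(b + Pi.single i 1 : Fin n → ℕ) k]
        (compList (l.map fun j => (D j)^[(b + Pi.single i 1 : Fin n → ℕ) j]) x)
      = if i ∈ k :: l then (D k)^[b k] (compList (l.map fun j => (D j)^[b j]) (D i x))
        else (D k)^[b k] (compList (l.map fun j => (D j)^[b j]) x)
    rw [ih]
    rcases eq_or_ne i k with rfl | hik
    · have h := compList_map_semiconj (g := D i) (f' := fun j => (D j)^[b j])
        (fun j => iterate_mem_of_mapsTo (hD j) (b j))
        (fun j => iterate_semiconj (hD j) (hc i j) (b j)) l x hx
      simp [hk, Function.iterate_succ_apply, h.2]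
    · by_cases hil : i ∈ l <;> simp [hil, hik, hik.symm]

lemma multiPow_add_single (hD : ∀ j, ∀ x ∈ S, D j x ∈ S)
    (hc : ∀ i j, ∀ x ∈ S, D i (D j x) = D j (D i x)) (b : Fin n → ℕ) (i : Fin n)
    {x : X} (hx : x ∈ S) : multiPow D (b + Pi.single i 1) x = multiPow D b (D i x) := by
  rw [multiPow, multiPow, List.ofFn_eq_map, List.ofFn_eq_map,
    compList_map_iterate_add_single hD hc b i _ (List.nodup_finRange n) hx]
  simp

lemma mdeg_add_single (b : Fin n → ℕ) (i : Fin n) : mdeg (b + Pi.single i 1) = mdeg b + 1 := by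
  simp [mdeg, Finset.sum_add_distrib]

end MultiPower

section Calculus

/-- The set of `C^∞` maps `ℝⁿ → A`. -/
def smoothMaps (n : ℕ) (A : Type) [NormedAddCommGroup A] [NormedSpace ℝ A] : Set (Rn n → A) :=
  {f | ∀ N : ℕ, ContDiff ℝ N f}

variable {B : Type} [NormedRing B]

lemma fdiff_sub (j : Fin n) (ρ σ : Rn n → B) : fdiff j (ρ - σ) = fdiff j ρ - fdiff j σ := by
  ext ξ
  simp only [fdiff, Pi.sub_apply]
  abel

lemma iterate_fdiff_sub (j : Fin n) (k : ℕ) (ρ σ : Rn n → B) :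
    (fdiff j)^[k] (ρ - σ) = (fdiff j)^[k] ρ - (fdiff j)^[k] σ := by
  induction k generalizing ρ σ with
  | zero => rfl
  | succ k ih => simp only [Function.iterate_succ_apply, fdiff_sub, ih]

variable [NormedAlgebra ℂ B]

lemma sub_eq_add_neg_one_smul (ρ σ : Rn n → B) : ρ - σ = ρ + (-1 : ℝ) • σ := by
  simp [sub_eq_add_neg]

lemma pd_mem_smoothMaps (j : Fin n) {f : Rn n → B} (hf : f ∈ smoothMaps n B) :
    pd j f ∈ smoothMaps n B := fun N =>
  ((hf (N + 1)).fderiv_right (m := N) (by norm_cast)).clm_apply contDiff_const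

lemma differentiable_of_mem_smoothMaps {f : Rn n → B} (hf : f ∈ smoothMaps n B) :
    Differentiable ℝ f := (hf 1).differentiable (by norm_num)

lemma pd_comm {f : Rn n → B} (hf : f ∈ smoothMaps n B) (i j : Fin n) :
    pd i (pd j f) = pd j (pd i f) := by
  have key : ∀ (i j : Fin n) ξ, pd i (pd j f) ξ = fderiv ℝ (fderiv ℝ f) ξ
      (EuclideanSpace.single i 1) (EuclideanSpace.single j 1) := fun i j ξ => by
    have hd : DifferentiableAt ℝ (fderiv ℝ f) ξ :=
      ((hf 2).fderiv_right (m := 1) (by norm_num)).differentiable (by norm_num) ξ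
    unfold pd
    rw [fderiv_clm_apply hd (differentiableAt_const _)]
    simp
  ext ξ
  rw [key, key]
  exact (hf 2).contDiffAt.isSymmSndFDerivAt (by simp) _ _

lemma add_smul_mem_smoothMaps {f g : Rn n → B} (hf : f ∈ smoothMaps n B) (hg : g ∈ smoothMaps n B)
    (c : ℝ) : f + c • g ∈ smoothMaps n B := fun N => (hf N).add ((hg N).const_smul c)

lemma pd_add_smul (j : Fin n) {f g : Rn n → B} (hf : f ∈ smoothMaps n B)
    (hg : g ∈ smoothMaps n B) (c : ℝ) : pd j (f + c • g) = pd j f + c • pd j g := by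
  ext ξ
  have hf := differentiable_of_mem_smoothMaps hf ξ
  have hg := differentiable_of_mem_smoothMaps hg ξ
  simp [pd, fderiv_add hf (hg.const_smul c), fderiv_const_smul hg]

lemma fdiff_mem_smoothMaps (j : Fin n) {f : Rn n → B} (hf : f ∈ smoothMaps n B) :
    fdiff j f ∈ smoothMaps n B := fun N =>
  ((hf N).comp (contDiff_id.add contDiff_const)).sub (hf N)

lemma pd_fdiff (i j : Fin n) {f : Rn n → B} (hf : f ∈ smoothMaps n B) :
    pd i (fdiff j f) = fdiff j (pd i f) := by
  ext ξ
  have hf := differentiable_of_mem_smoothMaps hf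
  have h : DifferentiableAt ℝ (fun η => f (η + EuclideanSpace.single j 1)) ξ :=
    (hf _).comp ξ (differentiableAt_id.add_const _)
  change fderiv ℝ (fun η => f (η + EuclideanSpace.single j 1) - f η) ξ _ = _
  rw [fderiv_fun_sub h (hf ξ), fderiv_comp_add_right]
  rfl

lemma hasDerivAt_comp_segment (j : Fin n) {f : Rn n → B} (hf : f ∈ smoothMaps n B) (ξ : Rn n)
    (t : ℝ) : HasDerivAt (fun t : ℝ => f (ξ + t • EuclideanSpace.single j (1 : ℝ)))
      (pd j f (ξ + t • EuclideanSpace.single j (1 : ℝ))) t := by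
  have h : HasDerivAt (fun t : ℝ => ξ + t • EuclideanSpace.single j (1 : ℝ))
      (EuclideanSpace.single j (1 : ℝ)) t := by
    simpa using ((hasDerivAt_id t).smul_const (EuclideanSpace.single j (1 : ℝ))).const_add ξ
  exact (differentiable_of_mem_smoothMaps hf _).hasFDerivAt.comp_hasDerivAt t h

lemma norm_fdiff_le (j : Fin n) {f : Rn n → B} (hf : f ∈ smoothMaps n B) (ξ : Rn n) {C : ℝ}
    (hC : ∀ t ∈ Set.Icc (0 : ℝ) 1, ‖pd j f (ξ + t • EuclideanSpace.single j (1 : ℝ))‖ ≤ C) :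
    ‖fdiff j f ξ‖ ≤ C := by
  simpa [fdiff] using norm_image_sub_le_of_norm_deriv_le_segment_01'
    (fun t _ => (hasDerivAt_comp_segment j hf ξ t).hasDerivWithinAt)
    (fun t ht => hC t ⟨ht.1, ht.2.le⟩)

lemma norm_fdiff_sub_pd_le (j : Fin n) {f : Rn n → B} (hf : f ∈ smoothMaps n B) (ξ : Rn n) {C : ℝ}
    (hC : ∀ t ∈ Set.Icc (0 : ℝ) 1,
      ‖pd j (pd j f) (ξ + t • EuclideanSpace.single j (1 : ℝ))‖ ≤ C) :
    ‖fdiff j f ξ - pd j f ξ‖ ≤ C := by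
  have hC0 : 0 ≤ C := (norm_nonneg _).trans (hC 0 ⟨le_rfl, zero_le_one⟩)
  have hbound : ∀ t ∈ Set.Icc (0 : ℝ) 1,
      ‖pd j f (ξ + t • EuclideanSpace.single j (1 : ℝ)) - pd j f ξ‖ ≤ C := fun t ht => by
    have h := norm_image_sub_le_of_norm_deriv_le_segment'
      (fun t _ => (hasDerivAt_comp_segment j (pd_mem_smoothMaps j hf) ξ t).hasDerivWithinAt)
      (fun t ht => hC t ⟨ht.1, ht.2.le⟩) t ht
    simp only [zero_smul, add_zero, sub_zero] at h
    exact h.trans (mul_le_of_le_one_right hC0 ht.2)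
  have h := norm_image_sub_le_of_norm_deriv_le_segment_01' (C := C)
    (f := fun t : ℝ => f (ξ + t • EuclideanSpace.single j (1 : ℝ)) - t • pd j f ξ)
    (fun t _ => ((hasDerivAt_comp_segment j hf ξ t).sub
      (by simpa using (hasDerivAt_id t).smul_const (pd j f ξ))).hasDerivWithinAt)
    (fun t ht => hbound t ⟨ht.1, ht.2.le⟩)
  simpa [fdiff, sub_right_comm] using h

lemma tendsto_slope_pd (j : Fin n) {f : Rn n → B} (hf : f ∈ smoothMaps n B) (ξ : Rn n) :
    Tendsto (fun t : ℝ => t⁻¹ • (f (ξ + t • EuclideanSpace.single j (1 : ℝ)) - f ξ)) (𝓝[≠] 0)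
      (𝓝 (pd j f ξ)) := by
  simpa using (hasDerivAt_comp_segment j hf ξ 0).tendsto_slope_zero

/-- The linear map `s ↦ i ∑ s_j w_j`. -/
def gradCLM (w : Fin n → B) : Rn n →L[ℝ] B :=
  ∑ j, (EuclideanSpace.proj j : Rn n →L[ℝ] ℝ).smulRight (Complex.I • w j)

lemma gradCLM_single (w : Fin n → B) (j : Fin n) :
    gradCLM w (EuclideanSpace.single j 1) = Complex.I • w j := by
  simp [gradCLM]

lemma continuous_gradCLM : Continuous (gradCLM : (Fin n → B) → (Rn n →L[ℝ] B)) :=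
  continuous_finsetSum _ fun j _ =>
    (ContinuousLinearMap.smulRightL ℝ (Rn n) B (EuclideanSpace.proj j)).continuous.comp
      ((continuous_apply j).const_smul _)

end Calculus

section Weight

lemma one_add_norm_rpow_le {E : Type*} [SeminormedAddCommGroup E] {x y : E} (hy : ‖y‖ ≤ 1)
    (p : ℝ) : (1 + ‖x + y‖) ^ p ≤ 2 ^ |p| * (1 + ‖x‖) ^ p := by
  have hx := norm_nonneg x
  have h1 : ‖x + y‖ ≤ ‖x‖ + ‖y‖ := norm_add_le x y
  have h2 : ‖x‖ ≤ ‖x + y‖ + ‖y‖ := by simpa using norm_sub_le (x + y) y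
  have hxy := norm_nonneg (x + y)
  rcases le_or_gt 0 p with hp | hp
  · rw [abs_of_nonneg hp, ← Real.mul_rpow (by norm_num) (by positivity)]
    exact Real.rpow_le_rpow (by positivity) (by linarith) hp
  · rw [abs_of_neg hp, Real.rpow_neg (by norm_num), ← Real.inv_rpow (by norm_num),
      ← Real.mul_rpow (by norm_num) (by positivity)]
    exact Real.rpow_le_rpow_of_nonpos (by positivity) (by linarith) hp.le

end Weight

section Action

variable {A : Type} [NormedRing A] [StarRing A] [NormedAlgebra ℂ A]

/-- `αa` is an action of `ℝⁿ` by isometries. -/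
structure IsIsometricAction (αa : Rn n → (A ≃⋆ₐ[ℂ] A)) : Prop where
  add_apply : ∀ s t (u : A), αa (s + t) u = αa s (αa t u)
  zero_apply : ∀ u : A, αa 0 u = u
  norm_apply : ∀ s (u : A), ‖αa s u‖ = ‖u‖

variable {αa : Rn n → (A ≃⋆ₐ[ℂ] A)}

/-- The orbit map `s ↦ α_s(u)`. -/
def orbit (αa : Rn n → (A ≃⋆ₐ[ℂ] A)) (u : A) : Rn n → A := fun s => αa s u

lemma act_real_smul (s : Rn n) (c : ℝ) (u : A) : αa s (c • u) = c • αa s u := by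
  rw [← Complex.coe_smul, map_smul, Complex.coe_smul]

/-- The automorphism `α_s` as a continuous `ℝ`-linear map. -/
def actCLM (h : IsIsometricAction αa) (s : Rn n) : A →L[ℝ] A :=
  LinearMap.mkContinuous
    { toFun := αa s
      map_add' := map_add (αa s)
      map_smul' := act_real_smul s } 1 fun u => by simpa using (h.norm_apply s u).le

lemma actCLM_apply (h : IsIsometricAction αa) (s : Rn n) (u : A) : actCLM h s u = αa s u := rfl

lemma norm_actCLM_le (h : IsIsometricAction αa) (s : Rn n) : ‖actCLM h s‖ ≤ 1 :=
  LinearMap.mkContinuous_norm_le _ zero_le_one _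

lemma mem_smoothSet_iff {u : A} : u ∈ SmoothSet αa ↔ orbit αa u ∈ smoothMaps n A := Iff.rfl

lemma orbit_add_smul (u v : A) (c : ℝ) : orbit αa (u + c • v) = orbit αa u + c • orbit αa v := by
  ext s
  simp [orbit, act_real_smul]

lemma add_smul_mem_smoothSet {u v : A} (hu : u ∈ SmoothSet αa) (hv : v ∈ SmoothSet αa) (c : ℝ) :
    u + c • v ∈ SmoothSet αa := by
  rw [mem_smoothSet_iff, orbit_add_smul]
  exact add_smul_mem_smoothMaps hu hv c

lemma δd_eq_pd_orbit (j : Fin n) (u : A) : δd αa j u = (-Complex.I) • pd j (orbit αa u) 0 := rfl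

lemma δd_add_smul (j : Fin n) {u v : A} (hu : u ∈ SmoothSet αa) (hv : v ∈ SmoothSet αa) (c : ℝ) :
    δd αa j (u + c • v) = δd αa j u + c • δd αa j v := by
  rw [mem_smoothSet_iff] at hu hv
  simp only [δd_eq_pd_orbit, orbit_add_smul, pd_add_smul j hu hv c, Pi.add_apply, Pi.smul_apply,
    smul_add, smul_comm c]

lemma hasFDerivAt_orbit (h : IsIsometricAction αa) {u : A} (hu : u ∈ SmoothSet αa) (s : Rn n) :
    HasFDerivAt (orbit αa u) ((actCLM h s).comp (fderiv ℝ (orbit αa u) 0)) s := by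
  have horb : orbit αa u = fun t => actCLM h s (orbit αa u (t - s)) := by
    ext t
    rw [actCLM_apply, orbit, orbit, ← h.add_apply, add_sub_cancel]
  have h0 : HasFDerivAt (orbit αa u) (fderiv ℝ (orbit αa u) 0) (s - s) := by
    rw [sub_self]
    exact (differentiable_of_mem_smoothMaps hu 0).hasFDerivAt
  nth_rw 1 [horb]
  exact (actCLM h s).hasFDerivAt.comp s
    (h0.comp s (f := fun t => t - s) ((hasFDerivAt_id s).sub_const s))

lemma orbit_δd (h : IsIsometricAction αa) (j : Fin n) {u : A} (hu : u ∈ SmoothSet αa) :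
    orbit αa (δd αa j u) = fun s => (-Complex.I) • pd j (orbit αa u) s := by
  ext s
  rw [orbit, δd_eq_pd_orbit, map_smul]
  simp only [pd, (hasFDerivAt_orbit h hu s).fderiv]
  rfl

lemma δd_mem_smoothSet (h : IsIsometricAction αa) (j : Fin n) {u : A} (hu : u ∈ SmoothSet αa) :
    δd αa j u ∈ SmoothSet αa := by
  rw [mem_smoothSet_iff, orbit_δd h j hu]
  exact fun N => (pd_mem_smoothMaps j hu N).const_smul _

lemma δd_comm (h : IsIsometricAction αa) (i j : Fin n) {u : A} (hu : u ∈ SmoothSet αa) :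
    δd αa i (δd αa j u) = δd αa j (δd αa i u) := by
  have key : ∀ i j : Fin n, δd αa i (δd αa j u) =
      (-Complex.I) • (-Complex.I) • pd i (pd j (orbit αa u)) 0 := fun i j => by
    have hd := differentiable_of_mem_smoothMaps
      (pd_mem_smoothMaps j (mem_smoothSet_iff.1 hu)) 0
    rw [δd_eq_pd_orbit, orbit_δd h j hu, pd, fderiv_fun_const_smul hd (-Complex.I)]
    rfl
  rw [key, key, pd_comm (mem_smoothSet_iff.1 hu)]

lemma fderiv_orbit_zero (u : A) :
    fderiv ℝ (orbit αa u) 0 = gradCLM fun j => δd αa j u := by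
  refine ContinuousLinearMap.coe_injective
    ((EuclideanSpace.basisFun (Fin n) ℝ).toBasis.ext fun j => ?_)
  simp [gradCLM_single, δd_eq_pd_orbit, pd, smul_smul]

lemma actCLM_comp_gradCLM (h : IsIsometricAction αa) (s : Rn n) (w : Fin n → A) :
    (actCLM h s).comp (gradCLM w) = gradCLM fun j => αa s (w j) := by
  refine ContinuousLinearMap.coe_injective
    ((EuclideanSpace.basisFun (Fin n) ℝ).toBasis.ext fun j => ?_)
  simp [gradCLM_single, actCLM_apply]

/-- The derivations `δ_j` are jointly closed. -/
lemma hasFDerivAt_orbit_of_tendsto (h : IsIsometricAction αa) {ι : Type*} {l : Filter ι} [l.NeBot]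
    {u : ι → A} (hu : ∀ t, u t ∈ SmoothSet αa) {v : A} {w : Fin n → A}
    (huv : Tendsto u l (𝓝 v)) (huw : ∀ j, Tendsto (fun t => δd αa j (u t)) l (𝓝 (w j)))
    (s : Rn n) : HasFDerivAt (orbit αa v) (gradCLM fun j => αa s (w j)) s := by
  have hgrad : Tendsto (fun t => gradCLM fun j => δd αa j (u t)) l (𝓝 (gradCLM w)) :=
    (continuous_gradCLM.tendsto w).comp (tendsto_pi_nhds.2 huw)
  refine hasFDerivAt_of_tendstoUniformly (l := l) (f := fun t => orbit αa (u t))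
    (f' := fun t s => (actCLM h s).comp (gradCLM fun j => δd αa j (u t)))
    (g' := fun s => gradCLM fun j => αa s (w j)) ?_ (fun t s => ?_) (fun s => ?_) s
  · rw [Metric.tendstoUniformly_iff]
    intro ε hε
    filter_upwards [Metric.tendsto_nhds.1 hgrad ε hε] with t ht s
    rw [← actCLM_comp_gradCLM h, dist_comm, dist_eq_norm, ← ContinuousLinearMap.comp_sub]
    rw [dist_eq_norm] at ht
    refine lt_of_le_of_lt (ContinuousLinearMap.opNorm_comp_le _ _) (lt_of_le_of_lt ?_ ht)
    exact mul_le_of_le_one_left (norm_nonneg _) (norm_actCLM_le h s)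
  · rw [← fderiv_orbit_zero]
    exact hasFDerivAt_orbit h (hu t) s
  · exact ((actCLM h s).continuous.tendsto v).comp huv

end Action

section SmoothFamilies

variable {A : Type} [NormedRing A] [StarRing A] [NormedAlgebra ℂ A]

variable {αa : Rn n → (A ≃⋆ₐ[ℂ] A)}

/-- The set of `C^∞` maps `ℝⁿ → 𝒜_θ`. -/
def smoothFamilies (αa : Rn n → (A ≃⋆ₐ[ℂ] A)) : Set (Rn n → A) :=
  {ρ | (∀ ξ, ρ ξ ∈ SmoothSet αa) ∧
    ∀ a : Fin n → ℕ, ∀ N : ℕ, ContDiff ℝ N fun ξ => δpow αa a (ρ ξ)}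

/-- The set of maps `ℝⁿ → A` with values in `𝒜_θ`. -/
def smoothValued (αa : Rn n → (A ≃⋆ₐ[ℂ] A)) : Set (Rn n → A) := {ρ | ∀ ξ, ρ ξ ∈ SmoothSet αa}

/-- The pointwise action of `δ_j` on maps `ℝⁿ → A`. -/
def δfam (αa : Rn n → (A ≃⋆ₐ[ℂ] A)) (j : Fin n) (ρ : Rn n → A) : Rn n → A :=
  fun ξ => δd αa j (ρ ξ)

lemma multiPow_δfam_apply (a : Fin n → ℕ) (ρ : Rn n → A) (ξ : Rn n) :
    multiPow (δfam αa) a ρ ξ = δpow αa a (ρ ξ) :=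
  multiPow_semiconj (D := δfam αa) (D' := δd αa) (S := Set.univ) (g := fun ρ : Rn n → A => ρ ξ)
    (fun _ _ _ => trivial) (fun _ _ _ => rfl) a trivial

lemma mem_smoothFamilies_iff {ρ : Rn n → A} : ρ ∈ smoothFamilies αa ↔
    (∀ ξ, ρ ξ ∈ SmoothSet αa) ∧ ∀ a : Fin n → ℕ, multiPow (δfam αa) a ρ ∈ smoothMaps n A := by
  simp only [smoothFamilies, smoothMaps, Set.mem_ofPred_eq, ← multiPow_δfam_apply]

lemma mem_smoothMaps_of_mem_smoothFamilies {ρ : Rn n → A} (hρ : ρ ∈ smoothFamilies αa) :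
    ρ ∈ smoothMaps n A := by
  have h := (mem_smoothFamilies_iff.1 hρ).2 0
  rwa [multiPow_zero] at h

lemma multiPow_add_single_δfam (h : IsIsometricAction αa) (a : Fin n → ℕ) (j : Fin n)
    {ρ : Rn n → A} (hρ : ∀ ξ, ρ ξ ∈ SmoothSet αa) :
    multiPow (δfam αa) (a + Pi.single j 1) ρ = multiPow (δfam αa) a (δfam αa j ρ) :=
  multiPow_add_single (D := δfam αa) (S := smoothValued αa)
    (fun j _ hρ ξ => δd_mem_smoothSet h j (hρ ξ))
    (fun i j _ hρ => funext fun ξ => δd_comm h i j (hρ ξ)) a j hρ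

lemma δfam_mem_smoothFamilies (h : IsIsometricAction αa) (j : Fin n) {ρ : Rn n → A}
    (hρ : ρ ∈ smoothFamilies αa) : δfam αa j ρ ∈ smoothFamilies αa := by
  rw [mem_smoothFamilies_iff] at hρ ⊢
  refine ⟨fun ξ => δd_mem_smoothSet h j (hρ.1 ξ), fun a => ?_⟩
  rw [← multiPow_add_single_δfam h a j hρ.1]
  exact hρ.2 _

lemma δfam_add_smul (j : Fin n) {ρ σ : Rn n → A} (hρ : ∀ ξ, ρ ξ ∈ SmoothSet αa)
    (hσ : ∀ ξ, σ ξ ∈ SmoothSet αa) (c : ℝ) :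
    δfam αa j (ρ + c • σ) = δfam αa j ρ + c • δfam αa j σ :=
  funext fun ξ => δd_add_smul j (hρ ξ) (hσ ξ) c

lemma add_smul_mem_smoothFamilies (h : IsIsometricAction αa) {ρ σ : Rn n → A}
    (hρ : ρ ∈ smoothFamilies αa) (hσ : σ ∈ smoothFamilies αa) (c : ℝ) :
    ρ + c • σ ∈ smoothFamilies αa := by
  rw [mem_smoothFamilies_iff] at hρ hσ ⊢
  refine ⟨fun ξ => add_smul_mem_smoothSet (hρ.1 ξ) (hσ.1 ξ) c, fun a => ?_⟩
  rw [multiPow_binop (D := δfam αa) (S := smoothValued αa) (op := fun ρ σ => ρ + c • σ)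
    (fun j _ hρ ξ => δd_mem_smoothSet h j (hρ ξ))
    (fun j _ hρ _ hσ => δfam_add_smul j hρ hσ c) a hρ.1 hσ.1]
  exact add_smul_mem_smoothMaps (hρ.2 a) (hσ.2 a) c

lemma δd_sub (j : Fin n) {u v : A} (hu : u ∈ SmoothSet αa) (hv : v ∈ SmoothSet αa) :
    δd αa j (u - v) = δd αa j u - δd αa j v := by
  simpa [sub_eq_add_neg] using δd_add_smul j hu hv (-1)

lemma sub_mem_smoothSet {u v : A} (hu : u ∈ SmoothSet αa) (hv : v ∈ SmoothSet αa) :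
    u - v ∈ SmoothSet αa := by
  simpa [sub_eq_add_neg] using add_smul_mem_smoothSet hu hv (-1)

lemma zero_mem_smoothSet : (0 : A) ∈ SmoothSet αa := fun N => by
  simpa using (contDiff_const : ContDiff ℝ N fun _ : Rn n => (0 : A))

lemma smul_mem_smoothSet {u : A} (hu : u ∈ SmoothSet αa) (c : ℝ) : c • u ∈ SmoothSet αa := by
  simpa using add_smul_mem_smoothSet zero_mem_smoothSet hu c

lemma δd_smul (j : Fin n) {u : A} (hu : u ∈ SmoothSet αa) (c : ℝ) :
    δd αa j (c • u) = c • δd αa j u := by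
  have h0 : δd αa j 0 = 0 := by
    simpa using δd_sub (αa := αa) j zero_mem_smoothSet zero_mem_smoothSet
  simpa [h0] using δd_add_smul j zero_mem_smoothSet hu c

lemma fdiff_mem_smoothFamilies (h : IsIsometricAction αa) (j : Fin n) {ρ : Rn n → A}
    (hρ : ρ ∈ smoothFamilies αa) : fdiff j ρ ∈ smoothFamilies αa := by
  rw [mem_smoothFamilies_iff] at hρ ⊢
  refine ⟨fun ξ => sub_mem_smoothSet (hρ.1 _) (hρ.1 _), fun a => ?_⟩
  rw [← multiPow_semiconj (D := δfam αa) (S := smoothValued αa)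
    (D' := δfam αa) (g := fdiff j)
    (fun j _ hρ ξ => δd_mem_smoothSet h j (hρ ξ))
    (fun i _ hρ => funext fun ξ => (δd_sub i (hρ _) (hρ _)).symm) a hρ.1]
  exact fdiff_mem_smoothMaps j (hρ.2 a)

lemma hasFDerivAt_orbit_pd (h : IsIsometricAction αa) (k : Fin n) {ρ : Rn n → A}
    (hρ : ρ ∈ smoothFamilies αa) (ξ s : Rn n) :
    HasFDerivAt (orbit αa (pd k ρ ξ)) (gradCLM fun j => orbit αa (pd k (δfam αa j ρ) ξ) s) s := by
  have hmem := hρ.1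
  refine hasFDerivAt_orbit_of_tendsto h (l := 𝓝[≠] (0 : ℝ))
    (fun t => smul_mem_smoothSet (sub_mem_smoothSet (hmem _) (hmem _)) t⁻¹)
    (tendsto_slope_pd k (mem_smoothMaps_of_mem_smoothFamilies hρ) ξ) (fun j => ?_) s
  simp only [δd_smul j (sub_mem_smoothSet (hmem _) (hmem _)), δd_sub j (hmem _) (hmem _)]
  exact tendsto_slope_pd k
    (mem_smoothMaps_of_mem_smoothFamilies (δfam_mem_smoothFamilies h j hρ)) ξ

lemma δfam_pd (h : IsIsometricAction αa) (j k : Fin n) {ρ : Rn n → A}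
    (hρ : ρ ∈ smoothFamilies αa) : δfam αa j (pd k ρ) = pd k (δfam αa j ρ) := by
  ext ξ
  rw [δfam, δd_eq_pd_orbit, pd, (hasFDerivAt_orbit_pd h k hρ ξ 0).fderiv, gradCLM_single, orbit,
    h.zero_apply, smul_smul]
  simp

lemma contDiff_orbit_pd (h : IsIsometricAction αa) (k : Fin n) (ξ : Rn n) (N : ℕ) :
    ∀ ρ ∈ smoothFamilies αa, ContDiff ℝ N (orbit αa (pd k ρ ξ)) := by
  induction N with
  | zero =>
    intro ρ hρ
    exact contDiff_zero.2 (continuous_iff_continuousAt.2 fun s =>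
      (hasFDerivAt_orbit_pd h k hρ ξ s).continuousAt)
  | succ N ih =>
    intro ρ hρ
    refine contDiff_succ_iff_hasFDerivAt.2 ⟨_, ?_, hasFDerivAt_orbit_pd h k hρ ξ⟩
    refine ContDiff.sum fun j _ => ?_
    exact (ContinuousLinearMap.smulRightL ℝ (Rn n) A (EuclideanSpace.proj j)).contDiff.comp
      ((ih _ (δfam_mem_smoothFamilies h j hρ)).const_smul Complex.I)

lemma pd_mem_smoothFamilies (h : IsIsometricAction αa) (k : Fin n) {ρ : Rn n → A}
    (hρ : ρ ∈ smoothFamilies αa) : pd k ρ ∈ smoothFamilies αa := by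
  refine mem_smoothFamilies_iff.2 ⟨fun ξ N => contDiff_orbit_pd h k ξ N ρ hρ, fun a => ?_⟩
  rw [← multiPow_semiconj (g := pd k) (fun j _ hρ => δfam_mem_smoothFamilies h j hρ)
    (fun j _ hρ => (δfam_pd h j k hρ).symm) a hρ]
  exact pd_mem_smoothMaps k ((mem_smoothFamilies_iff.1 hρ).2 a)

end SmoothFamilies

section Symbols

variable {A : Type} [NormedRing A] [StarRing A] [NormedAlgebra ℂ A]

variable {αa : Rn n → (A ≃⋆ₐ[ℂ] A)}

/-- The operator `ρ ↦ δ^a ∂_ξ^b ρ` on maps `ℝⁿ → A`. -/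
def δpdPow (αa : Rn n → (A ≃⋆ₐ[ℂ] A)) (a b : Fin n → ℕ) (ρ : Rn n → A) : Rn n → A :=
  multiPow (δfam αa) a (multiPow pd b ρ)

lemma isSymbol_iff {m : ℝ} {ρ : Rn n → A} : IsSymbol αa m ρ ↔ ρ ∈ smoothFamilies αa ∧
    ∀ a b : Fin n → ℕ, ∃ C > 0, ∀ ξ,
      ‖δpdPow αa a b ρ ξ‖ ≤ C * (1 + ‖ξ‖) ^ (m - (mdeg b : ℝ)) := by
  simp only [δpdPow, multiPow_δfam_apply]
  exact and_assoc.symm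

variable {a b : Fin n → ℕ} {ρ σ : Rn n → A}

lemma multiPow_pd_mem (h : IsIsometricAction αa) (hρ : ρ ∈ smoothFamilies αa) :
    multiPow pd b ρ ∈ smoothFamilies αa :=
  multiPow_mem (fun j _ hρ => pd_mem_smoothFamilies h j hρ) b hρ

lemma δpdPow_mem_smoothMaps (h : IsIsometricAction αa) (hρ : ρ ∈ smoothFamilies αa) :
    δpdPow αa a b ρ ∈ smoothMaps n A :=
  (mem_smoothFamilies_iff.1 (multiPow_pd_mem h hρ)).2 a

lemma δpdPow_pd (h : IsIsometricAction αa) (hρ : ρ ∈ smoothFamilies αa) (j : Fin n) :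
    δpdPow αa a b (pd j ρ) = pd j (δpdPow αa a b ρ) := by
  rw [δpdPow, δpdPow, multiPow_semiconj (g := pd j)
    (fun i _ hρ => δfam_mem_smoothFamilies h i hρ) (fun i _ hρ => (δfam_pd h i j hρ).symm) a
    (multiPow_pd_mem h hρ),
    multiPow_semiconj (D' := pd) (g := pd j) (fun i _ hf => pd_mem_smoothMaps i hf)
    (fun i _ hf => pd_comm hf j i) b (mem_smoothMaps_of_mem_smoothFamilies hρ)]

lemma δpdPow_fdiff (h : IsIsometricAction αa) (hρ : ρ ∈ smoothFamilies αa) (j : Fin n) :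
    δpdPow αa a b (fdiff j ρ) = fdiff j (δpdPow αa a b ρ) := by
  rw [δpdPow, δpdPow, multiPow_semiconj (D' := δfam αa) (g := fdiff j)
    (fun i _ hρ => δfam_mem_smoothFamilies h i hρ)
    (fun i _ hρ => funext fun _ => (δd_sub i (hρ.1 _) (hρ.1 _)).symm) a (multiPow_pd_mem h hρ),
    multiPow_semiconj (D' := pd) (g := fdiff j) (fun i _ hf => pd_mem_smoothMaps i hf)
    (fun i _ hf => (pd_fdiff i j hf).symm) b (mem_smoothMaps_of_mem_smoothFamilies hρ)]

lemma δpdPow_add_smul (h : IsIsometricAction αa) (hρ : ρ ∈ smoothFamilies αa)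
    (hσ : σ ∈ smoothFamilies αa) (c : ℝ) :
    δpdPow αa a b (ρ + c • σ) = δpdPow αa a b ρ + c • δpdPow αa a b σ := by
  rw [δpdPow, multiPow_binop (op := fun ρ σ => ρ + c • σ)
    (fun i _ hf => pd_mem_smoothMaps i hf) (fun i _ hf _ hg => pd_add_smul i hf hg c) b
    (mem_smoothMaps_of_mem_smoothFamilies hρ) (mem_smoothMaps_of_mem_smoothFamilies hσ),
    multiPow_binop (D := δfam αa) (op := fun ρ σ => ρ + c • σ)
    (fun i _ hρ => δfam_mem_smoothFamilies h i hρ)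
    (fun i _ hρ _ hσ => δfam_add_smul i hρ.1 hσ.1 c) a (multiPow_pd_mem h hρ)
    (multiPow_pd_mem h hσ)]
  rfl

variable {m : ℝ}

lemma isSymbol_add_smul (h : IsIsometricAction αa) (hρ : IsSymbol αa m ρ)
    (hσ : IsSymbol αa m σ) (c : ℝ) : IsSymbol αa m (ρ + c • σ) := by
  rw [isSymbol_iff] at hρ hσ ⊢
  refine ⟨add_smul_mem_smoothFamilies h hρ.1 hσ.1 c, fun a b => ?_⟩
  obtain ⟨C, hC, hρC⟩ := hρ.2 a b
  obtain ⟨C', hC', hσC'⟩ := hσ.2 a b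
  refine ⟨C + |c| * C', by positivity, fun ξ => ?_⟩
  rw [δpdPow_add_smul h hρ.1 hσ.1]
  calc ‖δpdPow αa a b ρ ξ + c • δpdPow αa a b σ ξ‖
      ≤ ‖δpdPow αa a b ρ ξ‖ + |c| * ‖δpdPow αa a b σ ξ‖ := by
        simpa [norm_smul] using norm_add_le (δpdPow αa a b ρ ξ) (c • δpdPow αa a b σ ξ)
    _ ≤ C * (1 + ‖ξ‖) ^ (m - (mdeg b : ℝ)) + |c| * (C' * (1 + ‖ξ‖) ^ (m - (mdeg b : ℝ))) := by
        gcongr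
        exacts [hρC ξ, hσC' ξ]
    _ = (C + |c| * C') * (1 + ‖ξ‖) ^ (m - (mdeg b : ℝ)) := by ring

lemma isSymbol_pd (h : IsIsometricAction αa) (hρ : IsSymbol αa m ρ) (j : Fin n) :
    IsSymbol αa (m - 1) (pd j ρ) := by
  rw [isSymbol_iff] at hρ ⊢
  refine ⟨pd_mem_smoothFamilies h j hρ.1, fun a b => ?_⟩
  obtain ⟨C, hC, hρC⟩ := hρ.2 a (b + Pi.single j 1)
  refine ⟨C, hC, fun ξ => ?_⟩
  have hpd : δpdPow αa a b (pd j ρ) = δpdPow αa a (b + Pi.single j 1) ρ := by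
    rw [δpdPow, δpdPow, multiPow_add_single (fun i _ hf => pd_mem_smoothMaps i hf)
      (fun i k _ hf => pd_comm hf i k) b j (mem_smoothMaps_of_mem_smoothFamilies hρ.1)]
  rw [hpd]
  convert hρC ξ using 3
  rw [mdeg_add_single]
  push_cast
  ring

/-- A bound for a symbol at `ξ` controls the symbol on the segments of length one from `ξ`. -/
lemma exists_bound_segment (hρ : IsSymbol αa m ρ) (a b : Fin n → ℕ) (j : Fin n) :
    ∃ C > 0, ∀ ξ, ∀ t ∈ Set.Icc (0 : ℝ) 1,
      ‖δpdPow αa a b ρ (ξ + t • EuclideanSpace.single j (1 : ℝ))‖ ≤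
        C * (1 + ‖ξ‖) ^ (m - (mdeg b : ℝ)) := by
  obtain ⟨C, hC, hρC⟩ := (isSymbol_iff.1 hρ).2 a b
  refine ⟨C * 2 ^ |m - (mdeg b : ℝ)|, by positivity, fun ξ t ht => (hρC _).trans ?_⟩
  have hnorm : ‖t • EuclideanSpace.single j (1 : ℝ)‖ ≤ 1 := by
    simpa [norm_smul, abs_of_nonneg ht.1] using ht.2
  rw [mul_assoc]
  exact mul_le_mul_of_nonneg_left (one_add_norm_rpow_le hnorm _) hC.le

lemma isSymbol_fdiff (h : IsIsometricAction αa) (hρ : IsSymbol αa m ρ) (j : Fin n) :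
    IsSymbol αa (m - 1) (fdiff j ρ) := by
  have hmem := (isSymbol_iff.1 hρ).1
  refine isSymbol_iff.2 ⟨fdiff_mem_smoothFamilies h j hmem, fun a b => ?_⟩
  obtain ⟨C, hC, hbound⟩ := exists_bound_segment (isSymbol_pd h hρ j) a b j
  refine ⟨C, hC, fun ξ => ?_⟩
  rw [δpdPow_fdiff h hmem]
  rw [δpdPow_pd h hmem] at hbound
  exact norm_fdiff_le j (δpdPow_mem_smoothMaps h hmem) ξ (hbound ξ)

lemma isSymbol_fdiff_sub_pd (h : IsIsometricAction αa) (hρ : IsSymbol αa m ρ) (j : Fin n) :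
    IsSymbol αa (m - 1 - 1) (fdiff j ρ - pd j ρ) := by
  have hmem := (isSymbol_iff.1 hρ).1
  have hpd := pd_mem_smoothFamilies h j hmem
  have hfd := fdiff_mem_smoothFamilies h j hmem
  rw [sub_eq_add_neg_one_smul]
  refine isSymbol_iff.2 ⟨add_smul_mem_smoothFamilies h hfd hpd _, fun a b => ?_⟩
  obtain ⟨C, hC, hbound⟩ := exists_bound_segment (isSymbol_pd h (isSymbol_pd h hρ j) j) a b j
  refine ⟨C, hC, fun ξ => ?_⟩
  rw [δpdPow_add_smul h hfd hpd, ← sub_eq_add_neg_one_smul, δpdPow_fdiff h hmem,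
    δpdPow_pd h hmem]
  rw [δpdPow_pd h hpd, δpdPow_pd h hmem] at hbound
  exact norm_fdiff_sub_pd_le j (δpdPow_mem_smoothMaps h hmem) ξ (hbound ξ)

/-- `T` and `T'` lower the order of symbols by `k`, and their difference lowers it by `k + 1`. -/
def AgreeToLeadingOrder (αa : Rn n → (A ≃⋆ₐ[ℂ] A)) (k : ℕ)
    (T T' : (Rn n → A) → (Rn n → A)) : Prop :=
  ∀ m ρ, IsSymbol αa m ρ →
    IsSymbol αa (m - k) (T ρ) ∧ IsSymbol αa (m - k) (T' ρ) ∧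
      IsSymbol αa (m - k - 1) (T ρ - T' ρ)

variable {k l : ℕ} {S S' T T' : (Rn n → A) → (Rn n → A)}

lemma agreeToLeadingOrder_fdiff_pd (h : IsIsometricAction αa) (j : Fin n) :
    AgreeToLeadingOrder αa 1 (fdiff j) (pd j) := fun m ρ hρ => by
  simpa using ⟨isSymbol_fdiff h hρ j, isSymbol_pd h hρ j, isSymbol_fdiff_sub_pd h hρ j⟩

lemma isSymbol_zero (h : IsIsometricAction αa) (hρ : IsSymbol αa m ρ) (m' : ℝ) :
    IsSymbol αa m' (0 : Rn n → A) := by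
  have h0 : ρ + (-1 : ℝ) • ρ = 0 := by simp
  have hmem := (isSymbol_iff.1 hρ).1
  rw [isSymbol_iff, ← h0]
  refine ⟨add_smul_mem_smoothFamilies h hmem hmem _, fun a b => ⟨1, one_pos, fun ξ => ?_⟩⟩
  rw [δpdPow_add_smul h hmem hmem, ← sub_eq_add_neg_one_smul, sub_self, Pi.zero_apply, norm_zero]
  positivity

lemma agreeToLeadingOrder_id (h : IsIsometricAction αa) :
    AgreeToLeadingOrder αa 0 id id := fun m ρ hρ => by
  simpa using ⟨hρ, isSymbol_zero h hρ _⟩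

lemma AgreeToLeadingOrder.comp (h : IsIsometricAction αa)
    (hS : AgreeToLeadingOrder αa k S S') (hSsub : ∀ ρ σ, S (ρ - σ) = S ρ - S σ)
    (hT : AgreeToLeadingOrder αa l T T') :
    AgreeToLeadingOrder αa (k + l) (S ∘ T) (S' ∘ T') := by
  intro m ρ hρ
  obtain ⟨h1, h2, h3⟩ := hT m ρ hρ
  have hkl : m - ((k + l : ℕ) : ℝ) = m - l - k := by
    push_cast
    ring
  have hdecomp : (S ∘ T) ρ - (S' ∘ T') ρ = S (T ρ - T' ρ) + (1 : ℝ) • (S (T' ρ) - S' (T' ρ)) := by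
    simp [hSsub]
  rw [hkl, hdecomp]
  refine ⟨(hS _ _ h1).1, (hS _ _ h2).2.1, isSymbol_add_smul h ?_ (hS _ _ h2).2.2 1⟩
  have h4 := (hS _ _ h3).1
  rwa [sub_right_comm] at h4

lemma AgreeToLeadingOrder.iterate (h : IsIsometricAction αa)
    (hS : AgreeToLeadingOrder αa 1 S S') (hSsub : ∀ ρ σ, S (ρ - σ) = S ρ - S σ) (k : ℕ) :
    AgreeToLeadingOrder αa k S^[k] S'^[k] := by
  induction k with
  | zero => exact agreeToLeadingOrder_id h
  | succ k ih =>
    rw [Function.iterate_succ', Function.iterate_succ', add_comm]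
    exact hS.comp h hSsub ih

lemma agreeToLeadingOrder_compList (h : IsIsometricAction αa) (b : Fin n → ℕ)
    (l : List (Fin n)) :
    AgreeToLeadingOrder αa (l.map b).sum (compList (l.map fun j => (fdiff j)^[b j]))
      (compList (l.map fun j => (pd j)^[b j])) := by
  induction l with
  | nil => exact agreeToLeadingOrder_id h
  | cons j l ih =>
    rw [List.map_cons, List.sum_cons]
    have hj := (agreeToLeadingOrder_fdiff_pd h j).iterate h (fdiff_sub j) (b j)
    have hcomp := hj.comp h (iterate_fdiff_sub j (b j)) ih
    exact hcomp

lemma agreeToLeadingOrder_fdiffPow_pdPow (h : IsIsometricAction αa) (b : Fin n → ℕ) :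
    AgreeToLeadingOrder αa (mdeg b) (fdiffPow b) (pdPow b) := by
  have hdeg : mdeg b = ((List.finRange n).map b).sum := by
    rw [mdeg, ← List.sum_ofFn, List.ofFn_eq_map]
  rw [fdiffPow, pdPow, List.ofFn_eq_map, List.ofFn_eq_map, hdeg]
  exact agreeToLeadingOrder_compList h b _

end Symbols

/-- for `ρ ∈ 𝕊^m(ℝⁿ;𝒜_θ)` and every multi-order `α`, the iterated finite
difference `Δ^α ρ` belongs to `𝕊^{m−|α|}(ℝⁿ;𝒜_θ)` and `Δ^α ρ − ∂_ξ^α ρ` belongs to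
`𝕊^{m−|α|−1}(ℝⁿ;𝒜_θ)`. -/
theorem statement_17
    {n : ℕ} (hn : 2 ≤ n)
    {A : Type} [NormedRing A] [StarRing A] [CStarRing A] [NormedAlgebra ℂ A]
    [StarModule ℂ A] [CompleteSpace A]
    (αa : Rn n → (A ≃⋆ₐ[ℂ] A))
    (hαadd : ∀ s t (u : A), αa (s + t) u = αa s (αa t u))
    (hα0 : ∀ u : A, αa 0 u = u)
    (hαiso : ∀ s (u : A), ‖αa s u‖ = ‖u‖)
    (m : ℝ) (ρ : Rn n → A) (hρ : IsSymbol αa m ρ) :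
    ∀ a : Fin n → ℕ,
      IsSymbol αa (m - mdeg a) (fdiffPow a ρ) ∧
      IsSymbol αa (m - mdeg a - 1) (fdiffPow a ρ - pdPow a ρ) := by
  intro a
  have h := agreeToLeadingOrder_fdiffPow_pdPow ⟨hαadd, hα0, hαiso⟩ a m ρ hρ
  exact ⟨h.1, h.2.2⟩
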